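/- Let y ∈ W^{1,p}(Ω;ℝ³) be almost everywhere injective with det ∇y > 0 almost everywhere in Ω. Then the following integral identities hold: ∫_{Ω^y} |∇(y^{-1})| dξ = ∫_Ω |adj ∇y| dx, ∫_{Ω^y} |adj ∇(y^{-1})| dξ = ∫_Ω |∇y| dx, and ∫_{Ω^y} det ∇(y^{-1}) dξ = ℒ³(Ω). -/

import Mathlib

noncomputable section
open MeasureTheory Set Filter Topology

/-- We model `ℝ³` as `Fin 3 → ℝ` (with Lebesgue measure `volume`). -/
abbrev V3 := Fin 3 → ℝ
/-- 3×3 real matrices. -/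
abbrev M3 := Matrix (Fin 3) (Fin 3) ℝ

/-- Euclidean norm of a vector in `ℝ³`. -/
def vnorm (v : V3) : ℝ := Real.sqrt (∑ i, (v i) ^ 2)

/-- Frobenius norm of a matrix. -/
def mnorm (A : M3) : ℝ := Real.sqrt (∑ i, ∑ j, (A i j) ^ 2)

/-- The (a.e.-defined) gradient matrix of `y : ℝ³ → ℝ³`, `(∇y)_{ij} = ∂_j y_i`. -/
def gradM (y : V3 → V3) (x : V3) : M3 := Matrix.of fun i j => fderiv ℝ y x (Pi.single j 1) i

/-- Jacobian determinant `det ∇y`. -/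
def detG (y : V3 → V3) (x : V3) : ℝ := (gradM y x).det

/-- Cofactor matrix `cof A` (transpose of the adjugate). -/
def cofM (A : M3) : M3 := Matrix.transpose (Matrix.adjugate A)

/-- `adj A`, the transpose of the cofactor matrix (the classical adjugate). -/
def adjM (A : M3) : M3 := Matrix.adjugate A

/-- Gradient (as a vector) of a scalar function on `ℝ³`. -/
def gradS (φ : V3 → ℝ) (ξ : V3) : V3 := fun j => fderiv ℝ φ ξ (Pi.single j 1)

/-- Divergence of a vector field on `ℝ³`. -/
def divV (ψ : V3 → V3) (ξ : V3) : ℝ := ∑ i, fderiv ℝ ψ ξ (Pi.single i 1) i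

/-- The deformed configuration `Ω^y := y(Ω) \ y(∂Ω)`. -/
def defConfig (y : V3 → V3) (Ω : Set V3) : Set V3 := y '' Ω \ y '' frontier Ω

/-- `y` is almost everywhere injective on `Ω`: injective off a Lebesgue-null set. -/
def AEInjOn (y : V3 → V3) (Ω : Set V3) : Prop :=
  ∃ X ⊆ Ω, volume X = 0 ∧ Set.InjOn y (Ω \ X)

/-- Membership in `W^{1,p}(Ω;ℝ³)` (`p > 3`), identified with the continuous representative:
continuity up to the boundary, a.e. differentiability, and `L^p`-integrability of the
gradient. -/
def W1p (y : V3 → V3) (Ω : Set V3) (p : ℝ) : Prop :=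
  ContinuousOn y (closure Ω) ∧
  (∀ᵐ x ∂volume.restrict Ω, DifferentiableAt ℝ y x) ∧
  (∫⁻ x in Ω, ENNReal.ofReal (mnorm (gradM y x) ^ p)) < ⊤

/-- Lusin property (N) on a set `s`: null sets are mapped to null sets. -/
def LusinN (y : V3 → V3) (s : Set V3) : Prop :=
  ∀ A ⊆ s, volume A = 0 → volume (y '' A) = 0

/-- `v` is (a representative of) the inverse of the a.e. injective map `y`:
`v ∘ y = id` a.e. in `Ω` and `y ∘ v = id` a.e. in `Ω^y`. -/
def IsAEInverse (y v : V3 → V3) (Ω : Set V3) : Prop :=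
  (∀ᵐ x ∂volume.restrict Ω, v (y x) = x) ∧
  (∀ᵐ ξ ∂volume.restrict (defConfig y Ω), y (v ξ) = ξ)

/-- The gradient of the inverse map, given by the formula `(∇y)⁻¹ ∘ y⁻¹`. -/
def invGrad (y v : V3 → V3) (ξ : V3) : M3 := (gradM y (v ξ))⁻¹

/-- `G` is the weak (distributional) gradient of `v` on the open set `U`
(componentwise integration by parts against `C_c^∞(U)` test functions). -/
def HasWeakGradientOn (v : V3 → V3) (G : V3 → M3) (U : Set V3) : Prop :=
  ∀ ψ : V3 → ℝ, ContDiff ℝ (⊤ : ℕ∞) ψ → HasCompactSupport ψ → tsupport ψ ⊆ U →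
    ∀ i j : Fin 3,
      (∫ ξ in U, v ξ i * gradS ψ ξ j) = -∫ ξ in U, ψ ξ * G ξ i j

abbrev E3 := EuclideanSpace ℝ (Fin 3)

lemma det_one_add_smul_three (M : Matrix (Fin 3) (Fin 3) ℝ) (t : ℝ) :
    (1 + t • M).det = 1 + t * M.trace + t ^ 2 * M.adjugate.trace + t ^ 3 * M.det := by
  simp only [Matrix.det_fin_three, Matrix.trace_fin_three, Matrix.adjugate_fin_three,
    Matrix.add_apply, Matrix.smul_apply, Matrix.one_apply, smul_eq_mul, Matrix.of_apply,
    Matrix.cons_val', Matrix.cons_val_zero, Matrix.cons_val_one, Matrix.cons_val]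
  simp
  ring

/-- The matrix of a continuous linear endomorphism of `E3`. -/
def matE (A : E3 →L[ℝ] E3) : Matrix (Fin 3) (Fin 3) ℝ :=
  LinearMap.toMatrix (EuclideanSpace.basisFun (Fin 3) ℝ).toBasis
    (EuclideanSpace.basisFun (Fin 3) ℝ).toBasis A.toLinearMap

lemma det_matE (A : E3 →L[ℝ] E3) (t : ℝ) :
    (ContinuousLinearMap.id ℝ E3 + t • A).det = (1 + t • matE A).det := by
  unfold matE ContinuousLinearMap.det
  rw [← LinearMap.det_toMatrix (EuclideanSpace.basisFun (Fin 3) ℝ).toBasis]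
  congr 1
  rw [ContinuousLinearMap.toLinearMap_add, ContinuousLinearMap.toLinearMap_smul, map_add, map_smul,
    ContinuousLinearMap.coe_id, LinearMap.toMatrix_id]

lemma continuous_matE : Continuous matE := by
  unfold matE
  refine continuous_matrix fun i j => ?_
  simp only [LinearMap.toMatrix_apply]
  simp
  fun_prop

/-- Extension by zero outside the ball is Lipschitz. -/
lemma lipschitz_ext {h : E3 → E3} {R : ℝ} {K : NNReal}
    (hK : LipschitzOnWith K h (Metric.closedBall 0 R)) (h0 : ∀ x, ‖x‖ = R → h x = 0) :
    LipschitzWith K (fun x => if ‖x‖ ≤ R then h x else 0) := by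
  have key : ∀ x z : E3, ‖x‖ ≤ R → R < ‖z‖ → ‖h x‖ ≤ K * ‖x - z‖ := by
    intro x z hx hz
    have hc : ContinuousOn (fun t : ℝ => ‖x + t • (z - x)‖) (Icc 0 1) := by fun_prop
    have := intermediate_value_Icc zero_le_one hc
    obtain ⟨t, ht, hts⟩ := this (show R ∈ Icc _ _ by constructor <;> simp <;> linarith)
    have h1 := hK.norm_sub_le (x := x) (y := x + t • (z - x)) (by simpa using hx)
      (by simpa using hts.le)
    rw [h0 _ hts, sub_zero] at h1
    refine h1.trans ?_
    have : ‖x - (x + t • (z - x))‖ = t * ‖x - z‖ := by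
      rw [show x - (x + t • (z - x)) = t • (x - z) by module, norm_smul, Real.norm_of_nonneg ht.1]
    rw [this]
    gcongr
    exact mul_le_of_le_one_left (norm_nonneg _) ht.2
  refine LipschitzWith.of_dist_le_mul fun x z => ?_
  rw [dist_eq_norm, dist_eq_norm]
  by_cases hx : ‖x‖ ≤ R <;> by_cases hz : ‖z‖ ≤ R
  · simp only [hx, hz, if_true]
    exact hK.norm_sub_le (by simpa using hx) (by simpa using hz)
  · simp only [hx, hz, if_true, if_false, sub_zero]
    exact key x z hx (not_le.1 hz)
  · simp only [hx, hz, if_true, if_false, zero_sub, norm_neg]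
    rw [norm_sub_rev]
    exact key z x hz (not_le.1 hx)
  · simp only [hx, hz, if_false, sub_zero, norm_zero]
    positivity

lemma cubic_aux {a b c d V t : ℝ} (ht : 0 < t)
    (h : ∀ s, 0 < s → s ≤ t → a + s * b + s ^ 2 * c + s ^ 3 * d = V) (ha : a = V) :
    a + b + c + d = V := by
  have h1 := h t ht le_rfl
  have h2 := h (t / 2) (by linarith) (by linarith)
  have h3 := h (t / 3) (by linarith) (by linarith)
  have e1 : b + t * c + t ^ 2 * d = 0 := by
    apply mul_left_cancel₀ ht.ne'; linear_combination h1 - ha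
  have e2 : b + t / 2 * c + t ^ 2 / 4 * d = 0 := by
    apply mul_left_cancel₀ ht.ne'; linear_combination 2 * (h2 - ha)
  have e3 : b + t / 3 * c + t ^ 2 / 9 * d = 0 := by
    apply mul_left_cancel₀ ht.ne'; linear_combination 3 * (h3 - ha)
  have f1 : c + t * (3 / 2) * d = 0 := by
    apply mul_left_cancel₀ ht.ne'; linear_combination 2 * (e1 - e2)
  have f2 : c + t * (5 / 6) * d = 0 := by
    apply mul_left_cancel₀ ht.ne'; linear_combination 6 * (e2 - e3)
  have hd : d = 0 := by
    apply mul_left_cancel₀ ht.ne'; linear_combination (3 / 2) * (f1 - f2)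
  have hc : c = 0 := by rw [hd] at f1; linarith
  have hb : b = 0 := by rw [hd, hc] at e1; linarith
  rw [hb, hc, hd]; linarith

set_option maxHeartbeats 2000000 in
lemma no_retraction {g : E3 → E3} {R : ℝ} (hR : 0 < R) (hg : ContDiff ℝ 1 g)
    (hgS : ∀ x, ‖x‖ = R → g x = x) (hgR : ∀ x, ‖g x‖ = R) : False := by
  set h : E3 → E3 := fun x => g x - x with hh
  have hhd : ContDiff ℝ 1 h := hg.sub contDiff_id
  have hdiff : ∀ x, HasFDerivAt h (fderiv ℝ h x) x := fun x =>
    ((hhd.differentiable (by norm_num)) x).hasFDerivAt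
  have hcont : Continuous (fderiv ℝ h) := hhd.continuous_fderiv (by norm_num)
  set M := fun x => matE (fderiv ℝ h x) with hM
  have hMc : Continuous M := continuous_matE.comp hcont
  have c1 : Continuous fun x => (M x).trace := hMc.matrix_trace
  have c2 : Continuous fun x => (M x).adjugate.trace := hMc.matrix_adjugate.matrix_trace
  have c3 : Continuous fun x => (M x).det := hMc.matrix_det
  have hcpt : IsCompact (Metric.closedBall (0 : E3) R) := isCompact_closedBall _ _
  have bd : ∀ f : E3 → ℝ, Continuous f → ∃ C, 0 ≤ C ∧ ∀ x ∈ Metric.closedBall (0 : E3) R, |f x| ≤ C := by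
    intro f hf
    obtain ⟨C, hC⟩ := hcpt.exists_bound_of_continuousOn hf.continuousOn
    exact ⟨max C 0, le_max_right _ _, fun x hx => (hC x hx).trans (le_max_left _ _)⟩
  obtain ⟨C1, hC1, b1⟩ := bd _ c1
  obtain ⟨C2, hC2, b2⟩ := bd _ c2
  obtain ⟨C3, hC3, b3⟩ := bd _ c3
  obtain ⟨K, hK⟩ : ∃ K, LipschitzOnWith K h (Metric.closedBall 0 R) := by
    obtain ⟨C, hC⟩ := hcpt.exists_bound_of_continuousOn hcont.continuousOn
    refine ⟨C.toNNReal, (convex_closedBall (0 : E3) R).lipschitzOnWith_of_nnnorm_hasFDerivWithin_le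
      (fun x _ => (hdiff x).hasFDerivWithinAt) fun x hx => ?_⟩
    rw [← NNReal.coe_le_coe]
    exact (hC x hx).trans (Real.le_coe_toNNReal C)
  have hL := lipschitz_ext hK (fun x hx => by simp [hh, hgS x hx])
  set H : E3 → E3 := fun x => if ‖x‖ ≤ R then h x else 0 with hH
  set B := Metric.ball (0 : E3) R with hB
  have hBsub : B ⊆ Metric.closedBall (0 : E3) R := Metric.ball_subset_closedBall
  have hint : ∀ f : E3 → ℝ, Continuous f → IntegrableOn f B := fun f hf =>
    (hf.continuousOn.integrableOn_compact hcpt).mono_set hBsub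
  set t0 : ℝ := 1 / (2 * (1 + C1 + C2 + C3 + K)) with ht0
  have hKn : (0 : ℝ) ≤ K := K.2
  have hpos : 0 < 2 * (1 + C1 + C2 + C3 + (K : ℝ)) := by positivity
  have ht0p : 0 < t0 := by positivity
  have hdet : ∀ t : ℝ, ∀ x, (ContinuousLinearMap.id ℝ E3 + t • fderiv ℝ h x).det =
      1 + t * (M x).trace + t ^ 2 * (M x).adjugate.trace + t ^ 3 * (M x).det := by
    intro t x
    rw [det_matE, det_one_add_smul_three]
  have hintP : ∀ t : ℝ, ∫ x in B, (ContinuousLinearMap.id ℝ E3 + t • fderiv ℝ h x).det =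
      volume.real B + t * (∫ x in B, (M x).trace) + t ^ 2 * (∫ x in B, (M x).adjugate.trace)
        + t ^ 3 * ∫ x in B, (M x).det := by
    intro t
    simp_rw [hdet]
    have i1 := (hint _ c1).const_mul t
    have i2 := (hint _ c2).const_mul (t ^ 2)
    have i3 := (hint _ c3).const_mul (t ^ 3)
    have i0 : IntegrableOn (fun _ => (1 : ℝ)) B := hint _ continuous_const
    have i01 : Integrable (fun x => 1 + t * (M x).trace) (volume.restrict B) := i0.add i1
    have i012 : Integrable (fun x => 1 + t * (M x).trace + t ^ 2 * (M x).adjugate.trace)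
      (volume.restrict B) := i01.add i2
    rw [integral_add i012 i3, integral_add i01 i2, integral_add i0 i1,
      integral_const_mul, integral_const_mul, integral_const_mul]
    simp
  have hconst : ∀ t, 0 < t → t ≤ t0 →
      ∫ x in B, (ContinuousLinearMap.id ℝ E3 + t • fderiv ℝ h x).det = volume.real B := by
    intro t htp htt
    have hts : t * (2 * (1 + C1 + C2 + C3 + (K : ℝ))) ≤ 1 := by
      rw [ht0, le_div_iff₀ hpos] at htt; exact htt
    have m1 := mul_nonneg htp.le hC1
    have m2 := mul_nonneg htp.le hC2
    have m3 := mul_nonneg htp.le hC3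
    have m4 := mul_nonneg htp.le hKn
    have ht1 : t < 1 := by nlinarith
    have htK : t * K < 1 := by nlinarith
    set F : E3 → E3 := fun x => x + t • H x with hF
    have hap : ApproximatesLinearOn F ((ContinuousLinearEquiv.refl ℝ E3 : E3 ≃L[ℝ] E3) : E3 →L[ℝ] E3) univ
        (t.toNNReal * K) := by
      rw [ApproximatesLinearOn.approximatesLinearOn_iff_lipschitzOnWith, lipschitzOnWith_univ]
      have : F - ⇑((ContinuousLinearEquiv.refl ℝ E3 : E3 ≃L[ℝ] E3) : E3 →L[ℝ] E3) = fun x => t • H x := by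
        ext1 x; simp [hF]
      rw [this]
      refine LipschitzWith.of_dist_le_mul fun x z => ?_
      rw [dist_smul₀, Real.norm_of_nonneg htp.le, NNReal.coe_mul, Real.coe_toNNReal _ htp.le, mul_assoc]
      have := hL.dist_le_mul x z
      gcongr
    have hc : Subsingleton E3 ∨ t.toNNReal * K <
        ‖((ContinuousLinearEquiv.refl ℝ E3).symm : E3 →L[ℝ] E3)‖₊⁻¹ := by
      right
      have : ‖((ContinuousLinearEquiv.refl ℝ E3).symm : E3 →L[ℝ] E3)‖₊ = 1 := by
        rw [← NNReal.coe_inj]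
        exact ContinuousLinearMap.norm_id
      rw [this, inv_one, ← NNReal.coe_lt_coe]
      simpa [htp.le] using htK
    have hinj : InjOn F B := (hap.injOn hc).mono (subset_univ _)
    have hsurj := hap.surjective hc
    have hFout : ∀ x, R ≤ ‖x‖ → F x = x := by
      intro x hx
      rcases hx.eq_or_lt with hx | hx
      · simp [hF, hH, hh, hgS x hx.symm]
      · simp [hF, hH, not_le.2 hx]
    have hFin : ∀ x, ‖x‖ < R → F x = x + t • h x := fun x hx => by simp [hF, hH, hx.le]
    have himg : F '' B = B := by
      apply Subset.antisymm
      · rintro _ ⟨x, hx, rfl⟩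
        have hx' : ‖x‖ < R := by simpa [hB] using hx
        rw [hFin x hx', hB, mem_ball_zero_iff]
        have : x + t • h x = (1 - t) • x + t • g x := by simp only [hh]; module
        rw [this]
        calc _ ≤ ‖(1 - t) • x‖ + ‖t • g x‖ := norm_add_le _ _
          _ = (1 - t) * ‖x‖ + t * R := by
            rw [norm_smul, norm_smul, hgR, Real.norm_of_nonneg htp.le,
              Real.norm_of_nonneg (by linarith)]
          _ < R := by nlinarith
      · intro z hz
        obtain ⟨x, rfl⟩ := hsurj z
        refine ⟨x, ?_, rfl⟩
        by_contra hx
        have hx' : R ≤ ‖x‖ := by simpa [hB] using hx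
        rw [hFout x hx'] at hz
        exact hx hz
    have hFd : ∀ x ∈ B, HasFDerivWithinAt F (ContinuousLinearMap.id ℝ E3 + t • fderiv ℝ h x) B x := by
      intro x hx
      have h1 : HasFDerivAt (fun x => x + t • h x)
        (ContinuousLinearMap.id ℝ E3 + t • fderiv ℝ h x) x :=
        (hasFDerivAt_id x).add ((hdiff x).const_smul t)
      refine h1.hasFDerivWithinAt.congr (fun z hz => hFin z (by simpa [hB] using hz))
        (hFin x (by simpa [hB] using hx))
    have := integral_image_eq_integral_abs_det_fderiv_smul (volume : Measure E3)
      Metric.isOpen_ball.measurableSet hFd hinj (fun _ => (1 : ℝ))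
    rw [himg] at this
    simp only [smul_eq_mul, mul_one, integral_const, MeasurableSet.univ, measureReal_restrict_apply,
      univ_inter] at this
    rw [this]
    refine setIntegral_congr_fun Metric.isOpen_ball.measurableSet fun x hx => ?_
    refine (abs_of_nonneg ?_).symm
    rw [hdet]
    have a1 := abs_le.1 (b1 x (hBsub hx))
    have a2 := abs_le.1 (b2 x (hBsub hx))
    have a3 := abs_le.1 (b3 x (hBsub hx))
    have q1 : -(t * C1) ≤ t * (M x).trace := by nlinarith [a1.1]
    have ht2 : t ^ 2 ≤ t := by nlinarith
    have ht3 : t ^ 3 ≤ t := by nlinarith [sq_nonneg t]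
    have q2 : -(t * C2) ≤ t ^ 2 * (M x).adjugate.trace := by
      nlinarith [a2.1, mul_le_mul_of_nonneg_left a2.1 (sq_nonneg t), mul_le_mul_of_nonneg_right ht2 hC2]
    have q3 : -(t * C3) ≤ t ^ 3 * (M x).det := by
      have : 0 ≤ t ^ 3 := by positivity
      nlinarith [a3.1, mul_le_mul_of_nonneg_left a3.1 this, mul_le_mul_of_nonneg_right ht3 hC3]
    nlinarith
  have hone : ∫ x in B, (ContinuousLinearMap.id ℝ E3 + (1 : ℝ) • fderiv ℝ h x).det = 0 := by
    refine integral_eq_zero_of_ae (Eventually.of_forall fun x => ?_)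
    simp only [Pi.zero_apply]
    set A := ContinuousLinearMap.id ℝ E3 + (1 : ℝ) • fderiv ℝ h x with hA
    have hgA : HasFDerivAt g A x := by
      have h1 : HasFDerivAt (fun x => x + (1 : ℝ) • h x) A x :=
        (hasFDerivAt_id x).add ((hdiff x).const_smul (1 : ℝ))
      convert h1 using 1
      ext1 z; simp [hh]
    have hin : ∀ u, inner ℝ (g x) (A u) = 0 := by
      intro u
      have h1 := hgA.norm_sq
      have h2 : HasFDerivAt (fun x => ‖g x‖ ^ 2) (0 : E3 →L[ℝ] ℝ) x := by
        simp_rw [hgR]; exact hasFDerivAt_const _ _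
      have := congrArg (fun L : E3 →L[ℝ] ℝ => L u) (h1.unique h2)
      simpa using this
    by_contra hne
    have hs : Function.Surjective A.toLinearMap := by
      exact (A.toContinuousLinearEquivOfDetNeZero hne).surjective
    obtain ⟨u, hu⟩ := hs (g x)
    have := hin u
    rw [show A u = g x from hu, inner_self_eq_zero] at this
    have h3 := hgR x
    rw [this, norm_zero] at h3
    exact hR.ne h3
  have hV : 0 < volume.real B := by
    rw [measureReal_def]
    exact ENNReal.toReal_pos (Metric.measure_ball_pos _ _ hR).ne' measure_ball_lt_top.ne
  have := cubic_aux (a := volume.real B) (V := volume.real B) ht0p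
    (fun s hs hs' => by rw [← hintP, hconst s hs hs']) rfl
  rw [hintP] at hone
  linarith

lemma exists_zero {h : E3 → E3} {R : ℝ} (hR : 0 < R) (hc : Continuous h)
    (hs : ∀ x, R ≤ ‖x‖ → h x = 0) : ∃ x, x + h x = 0 := by
  by_contra! hne
  obtain ⟨δ, hδ, hb⟩ : ∃ δ > 0, ∀ x, δ ≤ ‖x + h x‖ := by
    obtain ⟨x0, -, hx0⟩ := (isCompact_closedBall (0 : E3) R).exists_isMinOn
      ⟨0, by simp [hR.le]⟩ (f := fun x => ‖x + h x‖) (by fun_prop)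
    refine ⟨min R ‖x0 + h x0‖, lt_min hR (norm_pos_iff.2 (hne x0)), fun x => ?_⟩
    rcases le_total ‖x‖ R with hx | hx
    · exact (min_le_right _ _).trans (hx0 (by simpa using hx))
    · rw [hs x hx, add_zero]; exact (min_le_left _ _).trans hx
  obtain ⟨k, hk, hkd, hks⟩ := hc.exists_contDiff_approx 1 (ε := fun _ => δ) continuous_const
    (fun _ => hδ)
  have hk1 : ContDiff ℝ 1 k := by exact_mod_cast hk
  have hk0 : ∀ x, R ≤ ‖x‖ → k x = 0 := by
    intro x hx
    by_contra h0
    exact hks h0 (hs x hx)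
  have hne' : ∀ x, x + k x ≠ 0 := by
    intro x h0
    have h1 := hkd x
    rw [dist_eq_norm] at h1
    have h2 : ‖x + h x‖ = ‖k x - h x‖ := by
      rw [← norm_neg]; congr 1
      rw [eq_neg_of_add_eq_zero_right h0]; abel
    linarith [hb x]
  have hf : ContDiff ℝ 1 fun x => x + k x := contDiff_id.add hk1
  refine no_retraction (g := fun x => (R / ‖x + k x‖) • (x + k x)) hR ?_ ?_ ?_
  · refine ContDiff.smul (f := fun x => R / ‖x + k x‖) ?_ hf
    exact contDiff_const.div (hf.norm ℝ hne') fun x => norm_ne_zero_iff.2 (hne' x)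
  · intro x hx
    simp [hk0 x hx.ge, hx, hR.ne']
  · intro x
    rw [norm_smul, norm_div, norm_norm, Real.norm_of_nonneg hR.le,
      div_mul_cancel₀ _ (norm_ne_zero_iff.2 (hne' x))]

lemma open_at_id {f : E3 → E3} {U : Set E3} (hU : U ∈ 𝓝 (0 : E3)) (hc : ContinuousOn f U)
    (h0 : f 0 = 0) (hd : HasFDerivAt f (ContinuousLinearMap.id ℝ E3) 0) : f '' U ∈ 𝓝 (0 : E3) := by
  have h1 := hd.isLittleO.def (show (0 : ℝ) < 1 / 8 by norm_num)
  simp only [h0, sub_zero, ContinuousLinearMap.id_apply] at h1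
  obtain ⟨r, hr, hrs⟩ := Metric.nhds_basis_closedBall.mem_iff.1 (inter_mem hU h1)
  refine mem_of_superset (Metric.ball_mem_nhds 0 (show 0 < r / 8 by positivity)) fun ξ hξ => ?_
  rw [mem_ball_zero_iff] at hξ
  set χ : E3 → ℝ := fun x => max 0 (min 1 (2 - 2 * ‖x‖ / r)) with hχ
  have hχ0 : ∀ x, r ≤ ‖x‖ → χ x = 0 := by
    intro x hx
    have : 1 ≤ ‖x‖ / r := (one_le_div hr).2 hx
    simp only [hχ]
    rw [max_eq_left]
    refine (min_le_right _ _).trans ?_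
    rw [mul_div_assoc]; linarith
  have hχ1 : ∀ x, ‖x‖ ≤ r / 2 → χ x = 1 := by
    intro x hx
    have : ‖x‖ / r ≤ 1 / 2 := by rw [div_le_iff₀ hr]; linarith
    simp only [hχ]
    rw [min_eq_left (by rw [mul_div_assoc]; linarith), max_eq_right zero_le_one]
  have hχb : ∀ x, 0 ≤ χ x ∧ χ x ≤ 1 := fun x =>
    ⟨le_max_left _ _, max_le zero_le_one (min_le_left _ _)⟩
  have hχc : Continuous χ := by fun_prop
  have hcr : ContinuousOn f (Metric.closedBall 0 r) := hc.mono fun x hx => (hrs hx).1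
  have hcont : Continuous fun x => χ x • (f x - x - ξ) := by
    have hu : Metric.closedBall (0 : E3) r ∪ {x | r ≤ ‖x‖} = univ := by
      ext x; simp [le_total]
    rw [← continuousOn_univ, ← hu]
    refine ContinuousOn.union_of_isClosed ?_ ?_ Metric.isClosed_closedBall
      (isClosed_le continuous_const continuous_norm)
    · fun_prop
    · refine (continuousOn_const (c := (0 : E3))).congr fun x hx => ?_
      simp [hχ0 x hx]
  obtain ⟨x, hx⟩ := exists_zero hr hcont (fun x hx => by simp [hχ0 x hx])
  have hxr : ‖x‖ < r := by
    by_contra! hxr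
    rw [hχ0 x hxr, zero_smul, add_zero] at hx
    rw [hx, norm_zero] at hxr
    linarith
  have hxm : x ∈ Metric.closedBall (0 : E3) r := by simpa using hxr.le
  have h2 : ‖f x - x‖ ≤ 1 / 8 * ‖x‖ := (hrs hxm).2
  have h3 : ‖x‖ ≤ r / 2 := by
    rw [eq_neg_of_add_eq_zero_left hx, norm_neg, norm_smul, Real.norm_of_nonneg (hχb x).1]
    calc _ ≤ 1 * ‖f x - x - ξ‖ := by gcongr; exact (hχb x).2
      _ ≤ ‖f x - x‖ + ‖ξ‖ := by rw [one_mul]; exact norm_sub_le _ _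
      _ ≤ _ := by linarith
  rw [hχ1 x h3, one_smul] at hx
  refine ⟨x, (hrs hxm).1, ?_⟩
  rw [← sub_eq_zero, ← hx]; abel

lemma open_at {f : (Fin 3 → ℝ) → (Fin 3 → ℝ)} {x : Fin 3 → ℝ} {U : Set (Fin 3 → ℝ)} (hU : U ∈ 𝓝 x)
    (hc : ContinuousOn f U) {A : (Fin 3 → ℝ) →L[ℝ] (Fin 3 → ℝ)} (hd : HasFDerivAt f A x)
    (hA : A.det ≠ 0) : f '' U ∈ 𝓝 (f x) := by
  let e : E3 ≃L[ℝ] (Fin 3 → ℝ) := EuclideanSpace.equiv (Fin 3) ℝ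
  let B : (Fin 3 → ℝ) ≃L[ℝ] (Fin 3 → ℝ) := A.toContinuousLinearEquivOfDetNeZero hA
  have hB : ∀ u, B u = A u := fun u => A.toContinuousLinearEquivOfDetNeZero_apply hA u
  let F : E3 → E3 := fun u => e.symm (B.symm (f (x + e u) - f x))
  have hte : Tendsto (fun u => x + e u) (𝓝 0) (𝓝 x) := by
    have : Continuous fun u => x + e u := by fun_prop
    simpa using this.tendsto 0
  have hUe : (fun u => x + e u) ⁻¹' U ∈ 𝓝 (0 : E3) := hte hU
  have hFd : HasFDerivAt F (ContinuousLinearMap.id ℝ E3) 0 := by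
    have h1 : HasFDerivAt (fun u => x + e u) (e : E3 →L[ℝ] (Fin 3 → ℝ)) 0 :=
      e.hasFDerivAt.const_add x
    have hd' : HasFDerivAt f A (x + e 0) := by simpa using hd
    have h2 := (hd'.comp (0 : E3) h1).sub_const (f x)
    have h3 := (e.symm.hasFDerivAt).comp (0 : E3) ((B.symm.hasFDerivAt).comp (0 : E3) h2)
    have hid : ContinuousLinearMap.id ℝ E3 =
        (e.symm : (Fin 3 → ℝ) →L[ℝ] E3).comp ((B.symm : (Fin 3 → ℝ) →L[ℝ] (Fin 3 → ℝ)).comp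
          (A.comp (e : E3 →L[ℝ] (Fin 3 → ℝ)))) := by
      ext1 u
      simp [← hB]
    rw [hid]
    exact h3
  have hFc : ContinuousOn F ((fun u => x + e u) ⁻¹' U) := by
    have h1 : ContinuousOn (fun u => f (x + e u)) ((fun u => x + e u) ⁻¹' U) :=
      hc.comp (by fun_prop) fun u hu => hu
    exact (e.symm.continuous.comp B.symm.continuous).comp_continuousOn (h1.sub continuousOn_const)
  have key := open_at_id hUe hFc (by simp [F]) hFd
  have ht : Tendsto (fun z => e.symm (B.symm (z - f x))) (𝓝 (f x)) (𝓝 0) := by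
    have : Continuous fun z => e.symm (B.symm (z - f x)) := by fun_prop
    simpa using this.tendsto (f x)
  refine mem_of_superset (ht key) ?_
  rintro z ⟨u, hu, huz⟩
  refine ⟨x + e u, hu, ?_⟩
  have := B.symm.injective (e.symm.injective huz)
  exact sub_left_injective this

lemma det_fderiv_eq (y : V3 → V3) (x : V3) : (fderiv ℝ y x).det = detG y x := by
  unfold detG ContinuousLinearMap.det
  rw [← LinearMap.det_toMatrix']
  congr 1

lemma mnorm_smul (c : ℝ) (hc : 0 ≤ c) (A : M3) : mnorm (c • A) = c * mnorm A := by
  unfold mnorm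
  have : ∑ i, ∑ j, ((c • A) i j) ^ 2 = c ^ 2 * ∑ i, ∑ j, (A i j) ^ 2 := by
    simp only [Matrix.smul_apply, smul_eq_mul, mul_pow, Finset.mul_sum]
  rw [this, Real.sqrt_mul (sq_nonneg c), Real.sqrt_sq hc]

lemma adj_inv (A : M3) (h : A.det ≠ 0) : A.det • adjM (A⁻¹) = A := by
  have hu : IsUnit A.det := isUnit_iff_ne_zero.2 h
  have h1 : A⁻¹ * (A⁻¹).adjugate = (A⁻¹).det • (1 : M3) := Matrix.mul_adjugate _
  have h2 : (A⁻¹).adjugate = (A⁻¹).det • A := by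
    calc (A⁻¹).adjugate = A * (A⁻¹ * (A⁻¹).adjugate) := by
          rw [← mul_assoc, Matrix.mul_nonsing_inv _ hu, one_mul]
      _ = _ := by rw [h1]; simp
  unfold adjM
  rw [h2, smul_smul, ← Matrix.det_mul, Matrix.mul_nonsing_inv _ hu, Matrix.det_one, one_smul]

lemma det_smul_inv (A : M3) (h : A.det ≠ 0) : A.det • A⁻¹ = adjM A := by
  rw [Matrix.inv_def, smul_smul, Ring.inverse_eq_inv', mul_inv_cancel₀ h, one_smul, adjM]

lemma ae_eq_of_null_diff {s t : Set V3} (hst : s ⊆ t) (h : volume (t \ s) = 0) :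
    (s : Set V3) =ᵐ[volume] t :=
  hst.eventuallyLE.antisymm (ae_le_set.2 h)

/-- Integral identities for the inverse.
Let `Ω ⊂ ℝ³` be a bounded Lipschitz domain, `p > 3`, and `y ∈ W^{1,p}(Ω;ℝ³)` a.e. injective
with `det ∇y > 0` a.e. in `Ω`; let `v` be (a representative of) the inverse `y⁻¹`, whose
gradient is `∇(y⁻¹) = (∇y)⁻¹ ∘ y⁻¹` a.e. in `Ω^y`. Then
`∫_{Ω^y} |∇(y⁻¹)| dξ = ∫_Ω |adj ∇y| dx`, `∫_{Ω^y} |adj ∇(y⁻¹)| dξ = ∫_Ω |∇y| dx`, and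
`∫_{Ω^y} det ∇(y⁻¹) dξ = ℒ³(Ω)`. -/
theorem inverse_integral_identities
    (Ω : Set V3) (hΩo : IsOpen Ω) (hΩb : Bornology.IsBounded Ω) (hΩne : Ω.Nonempty)
    (p : ℝ) (hp : 3 < p)
    (y : V3 → V3) (hy : W1p y Ω p)
    (hLusin : LusinN y (closure Ω))
    (hdet : ∀ᵐ x ∂volume.restrict Ω, 0 < detG y x)
    (hinj : AEInjOn y Ω)
    (v : V3 → V3) (hv : IsAEInverse y v Ω) :
    (∫ ξ in defConfig y Ω, mnorm (invGrad y v ξ)) = (∫ x in Ω, mnorm (adjM (gradM y x))) ∧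
    (∫ ξ in defConfig y Ω, mnorm (adjM (invGrad y v ξ))) = (∫ x in Ω, mnorm (gradM y x)) ∧
    (∫ ξ in defConfig y Ω, (invGrad y v ξ).det) = (volume Ω).toReal := by
  obtain ⟨hyc, hyd, -⟩ := hy
  have hyc' : ContinuousOn y Ω := hyc.mono subset_closure
  -- a measurable set of good points of full measure
  obtain ⟨S, hSΩ, hSm, hSnull, hSd, hSdet, hSv⟩ : ∃ S ⊆ Ω, MeasurableSet S ∧ volume (Ω \ S) = 0 ∧
      (∀ x ∈ S, DifferentiableAt ℝ y x) ∧ (∀ x ∈ S, 0 < detG y x) ∧ (∀ x ∈ S, v (y x) = x) := by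
    have hall : ∀ᵐ x ∂volume.restrict Ω, DifferentiableAt ℝ y x ∧ 0 < detG y x ∧ v (y x) = x := by
      filter_upwards [hyd, hdet, hv.1] with x h1 h2 h3 using ⟨h1, h2, h3⟩
    rw [ae_restrict_iff' hΩo.measurableSet, ae_iff] at hall
    set N := toMeasurable volume {x | ¬(x ∈ Ω → DifferentiableAt ℝ y x ∧ 0 < detG y x ∧ v (y x) = x)}
      with hN
    have hg : ∀ x ∈ Ω \ N, DifferentiableAt ℝ y x ∧ 0 < detG y x ∧ v (y x) = x := by
      intro x hx
      by_contra hcon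
      exact hx.2 (subset_toMeasurable _ _ (fun h => hcon (h hx.1)))
    refine ⟨Ω \ N, diff_subset, hΩo.measurableSet.diff (measurableSet_toMeasurable _ _), ?_,
      fun x hx => (hg x hx).1, fun x hx => (hg x hx).2.1, fun x hx => (hg x hx).2.2⟩
    refine measure_mono_null (t := N) ?_ (by rw [hN, measure_toMeasurable, hall])
    intro x hx
    by_contra h
    exact hx.2 ⟨hx.1, h⟩
  have hyN : volume (y '' (Ω \ S)) = 0 :=
    hLusin _ (diff_subset.trans subset_closure) hSnull
  have hopen : ∀ x ∈ S, ∀ U ∈ 𝓝 x, U ⊆ Ω → y '' U ∈ 𝓝 (y x) := by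
    intro x hx U hU hUΩ
    refine open_at hU (hyc'.mono hUΩ) (hSd x hx).hasFDerivAt ?_
    rw [det_fderiv_eq]
    exact (hSdet x hx).ne'
  have hSdense : ∀ O : Set V3, IsOpen O → O ⊆ Ω → O.Nonempty → (O ∩ S).Nonempty := by
    intro O hO hOΩ hne
    by_contra hcon
    have : O ⊆ Ω \ S := fun x hx => ⟨hOΩ hx, fun hxS => hcon ⟨x, hx, hxS⟩⟩
    exact (hO.measure_pos volume hne).ne' (measure_mono_null this hSnull)
  -- the images of good points avoid the image of the boundary
  have havoid : ∀ x ∈ S, y x ∉ y '' frontier Ω := by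
    rintro x hx ⟨z, hz, hzx⟩
    have hxz : x ≠ z := by
      rintro rfl
      rw [hΩo.frontier_eq] at hz
      exact hz.2 (hSΩ hx)
    obtain ⟨U, W, hU, hW, hxU, hzW, hUW⟩ := t2_separation hxz
    have hUΩ : y '' (U ∩ Ω) ∈ 𝓝 (y z) := by
      rw [hzx]
      exact hopen x hx _ ((hU.inter hΩo).mem_nhds ⟨hxU, hSΩ hx⟩) inter_subset_right
    have hzc : z ∈ closure Ω := frontier_subset_closure hz
    obtain ⟨O, hO, hzO, hOs⟩ := mem_nhdsWithin.1 (hyc z hzc hUΩ)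
    have hBo : IsOpen (O ∩ W ∩ Ω) := (hO.inter hW).inter hΩo
    have hBne : (O ∩ W ∩ Ω).Nonempty := mem_closure_iff.1 hzc _ (hO.inter hW) ⟨hzO, hzW⟩
    obtain ⟨w, hwB, hwS⟩ := hSdense _ hBo inter_subset_right hBne
    have hpos : 0 < volume (y '' (O ∩ W ∩ Ω)) :=
      Measure.measure_pos_of_mem_nhds _ (hopen w hwS _ (hBo.mem_nhds hwB) inter_subset_right)
    refine hpos.ne' (measure_mono_null ?_ hyN)
    rintro _ ⟨b, hb, rfl⟩
    by_cases hbS : b ∈ S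
    · obtain ⟨u, hu, hub⟩ := hOs ⟨hb.1.1, subset_closure hb.2⟩
      refine ⟨u, ⟨hu.2, fun huS => ?_⟩, hub⟩
      have : u = b := by rw [← hSv u huS, hub, hSv b hbS]
      exact Set.disjoint_left.1 hUW hu.1 (this ▸ hb.1.2)
    · exact ⟨b, ⟨hb.2, hbS⟩, rfl⟩
  have hsub : y '' S ⊆ defConfig y Ω := by
    rintro _ ⟨x, hx, rfl⟩
    exact ⟨⟨x, hSΩ hx, rfl⟩, havoid x hx⟩
  have hae : (defConfig y Ω : Set V3) =ᵐ[volume] y '' S := by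
    refine (ae_eq_of_null_diff hsub ?_).symm
    refine measure_mono_null ?_ hyN
    rintro _ ⟨⟨⟨x, hx, rfl⟩, -⟩, h2⟩
    exact ⟨x, ⟨hx, fun hxS => h2 ⟨x, hxS, rfl⟩⟩, rfl⟩
  have haeS : (Ω : Set V3) =ᵐ[volume] S :=
    (ae_eq_of_null_diff hSΩ hSnull).symm
  have hSinj : InjOn y S := fun a ha b hb hab => by rw [← hSv a ha, hab, hSv b hb]
  have hcv : ∀ (f g : M3 → ℝ), (∀ A : M3, 0 < A.det → A.det * f (A⁻¹) = g A) →
      (∫ ξ in defConfig y Ω, f (invGrad y v ξ)) = ∫ x in Ω, g (gradM y x) := by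
    intro f g hfg
    rw [setIntegral_congr_set hae, setIntegral_congr_set haeS,
      integral_image_eq_integral_abs_det_fderiv_smul volume hSm
        (fun x hx => (hSd x hx).hasFDerivAt.hasFDerivWithinAt) hSinj]
    refine setIntegral_congr_fun hSm fun x hx => ?_
    have hp : 0 < (gradM y x).det := hSdet x hx
    simp only [det_fderiv_eq, invGrad, hSv x hx, smul_eq_mul]
    rw [← hfg _ hp, abs_of_pos (hSdet x hx)]
    rfl
  refine ⟨?_, ?_, ?_⟩
  · refine hcv mnorm (fun A => mnorm (adjM A)) fun A hA => ?_
    rw [← mnorm_smul _ hA.le, det_smul_inv A hA.ne']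
  · refine hcv (fun A => mnorm (adjM A)) mnorm fun A hA => ?_
    rw [← mnorm_smul _ hA.le, adj_inv A hA.ne']
  · rw [hcv Matrix.det (fun _ => 1) fun A hA => ?_]
    · simp [measureReal_def]
    · rw [← Matrix.det_mul, Matrix.mul_nonsing_inv _ (isUnit_iff_ne_zero.2 hA.ne'), Matrix.det_one]
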